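/- Suppose β ≥ 0, m ∈ (−1,1) and lim_{N→∞} E[(1/N) log Z_{N,β,m}] = 0. Then for every ε > 0, lim_{N→∞} E[(1/N) log Z^{≤ε}_{N,β,m}] = 0. -/

import Mathlib

open MeasureTheory ProbabilityTheory Real Filter
open scoped NNReal

noncomputable section

/-- The law of the i.i.d. Gaussian couplings `(g_{ij})_{1 ≤ i,j ≤ N}`, each `N(0, 1/N)`. -/
def couplings (N : ℕ) : Measure (Fin N × Fin N → ℝ) :=
  Measure.pi fun _ : Fin N × Fin N => gaussianReal 0 ((N : ℝ≥0))⁻¹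

/-- The spin value (`±1`) encoded by a Boolean. -/
def spin (b : Bool) : ℝ := if b then 1 else -1

/-- The base product measure weight `p_m(σ) = ∏ i, (1 + m σ_i)/2`. -/
def pm (N : ℕ) (m : ℝ) (σ : Fin N → Bool) : ℝ :=
  ∏ i : Fin N, (1 + m * spin (σ i)) / 2

/-- The Hamiltonian `H_{N,β,m}(σ)`. -/
def ham (N : ℕ) (β m : ℝ) (g : Fin N × Fin N → ℝ) (σ : Fin N → Bool) : ℝ :=
  (β / Real.sqrt 2) * ∑ i : Fin N, ∑ j : Fin N,
      g (i, j) * (spin (σ i) - m) * (spin (σ j) - m)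
    - (β ^ 2 / (4 * N)) * ∑ i : Fin N, ∑ j : Fin N,
      (spin (σ i) - m) ^ 2 * (spin (σ j) - m) ^ 2

/-- The partition function `Z_{N,β,m}`. -/
def Z (N : ℕ) (β m : ℝ) (g : Fin N × Fin N → ℝ) : ℝ :=
  ∑ σ : Fin N → Bool, pm N m σ * Real.exp (ham N β m g σ)

/-- The set `S_{N,m,ε}` of configurations whose empirical magnetization is `ε`-close to `m`. -/
def SNset (N : ℕ) (m ε : ℝ) : Finset (Fin N → Bool) :=
  Finset.univ.filter fun σ =>
    (N : ℝ)⁻¹ * (∑ i : Fin N, spin (σ i)) ∈ Set.Icc (m - ε) (m + ε)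

/-- The restricted partition function `Z^{≤ε}_{N,β,m}`. -/
def Zres (N : ℕ) (β m ε : ℝ) (g : Fin N × Fin N → ℝ) : ℝ :=
  ∑ σ ∈ SNset N m ε, pm N m σ * Real.exp (ham N β m g σ)

/-- The quenched free energy `E[(1/N) log Z_{N,β,m}]`. -/
def F (N : ℕ) (β m : ℝ) : ℝ :=
  ∫ g, (N : ℝ)⁻¹ * Real.log (Z N β m g) ∂(couplings N)

/-- The restricted quenched free energy `F^{≤ε}_{N,β,m} = E[(1/N) log Z^{≤ε}_{N,β,m}]`. -/
def Fres (N : ℕ) (β m ε : ℝ) : ℝ :=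
  ∫ g, (N : ℝ)⁻¹ * Real.log (Zres N β m ε g) ∂(couplings N)

/-- The binary entropy function `I`. -/
def binEnt (s : ℝ) : ℝ :=
  -((1 + s) / 2) * Real.log ((1 + s) / 2) - ((1 - s) / 2) * Real.log ((1 - s) / 2)

/-- The centered Gaussian field `X_σ = (2N)^{-1/2} Σ_{ij} g_{ij} σ̂_i σ̂_j`. -/
def Xg (N : ℕ) (m : ℝ) (g : Fin N × Fin N → ℝ) (σ : Fin N → Bool) : ℝ :=
  (Real.sqrt (2 * N))⁻¹ * ∑ i : Fin N, ∑ j : Fin N,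
    g (i, j) * (spin (σ i) - m) * (spin (σ j) - m)

/-- The maximum `M_{N,m,ε} = max {X_σ : σ ∈ S_{N,m,ε}}`. -/
def Mmax (N : ℕ) (m ε : ℝ) (g : Fin N × Fin N → ℝ) : ℝ :=
  sSup ((fun σ => Xg N m g σ) '' (SNset N m ε : Set (Fin N → Bool)))

end

/-- A linear functional of the couplings has the Gaussian exponential moment. -/
lemma couplings_exp_linear (N : ℕ) (a : Fin N × Fin N → ℝ) :
    Integrable (fun g => Real.exp (∑ k, a k * g k)) (couplings N) ∧
      ∫ g, Real.exp (∑ k, a k * g k) ∂(couplings N) =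
        Real.exp ((∑ k, a k ^ 2) / (2 * N)) := by
  simp only [Real.exp_sum]
  refine ⟨Integrable.fintype_prod fun k => integrable_exp_mul_gaussianReal (a k), ?_⟩
  unfold couplings
  rw [integral_fintype_prod_eq_prod (fun k x => Real.exp (a k * x)), Finset.sum_div,
    Real.exp_sum]
  refine Finset.prod_congr rfl fun k _ => ?_
  have h := mgf_gaussianReal (p := gaussianReal 0 ((N : ℝ≥0))⁻¹) (X := id) Measure.map_id (a k)
  simp only [mgf, id] at h
  rw [h]
  congr 1
  push_cast
  by_cases hN : (N : ℝ) = 0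
  · simp [hN]
  · field_simp
    ring

instance couplings_isProbabilityMeasure (N : ℕ) : IsProbabilityMeasure (couplings N) := by
  unfold couplings
  infer_instance

lemma spin_eq_or (b : Bool) : spin b = 1 ∨ spin b = -1 := by
  cases b <;> simp [spin]

/-- The sum `∑ i j, σ̂_i² σ̂_j²`. -/
def quartic (N : ℕ) (m : ℝ) (σ : Fin N → Bool) : ℝ :=
  ∑ i : Fin N, ∑ j : Fin N, (spin (σ i) - m) ^ 2 * (spin (σ j) - m) ^ 2

lemma quartic_nonneg (N : ℕ) (m : ℝ) (σ : Fin N → Bool) : 0 ≤ quartic N m σ :=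
  Finset.sum_nonneg fun _ _ => Finset.sum_nonneg fun _ _ => by positivity

lemma quartic_le (N : ℕ) {m : ℝ} (hm : m ∈ Set.Ioo (-1 : ℝ) 1) (σ : Fin N → Bool) :
    quartic N m σ ≤ 16 * (N : ℝ) ^ 2 := by
  have h : ∀ b : Bool, (spin b - m) ^ 2 ≤ 4 := fun b => by
    obtain ⟨h1, h2⟩ := hm
    rcases spin_eq_or b with h | h <;> rw [h] <;> nlinarith
  calc quartic N m σ ≤ ∑ _i : Fin N, ∑ _j : Fin N, (4 * 4 : ℝ) :=
        Finset.sum_le_sum fun i _ => Finset.sum_le_sum fun j _ =>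
          mul_le_mul (h _) (h _) (sq_nonneg _) (by norm_num)
    _ = 16 * (N : ℝ) ^ 2 := by simp; ring

/-- Exponential moments of the Hamiltonian. -/
lemma exp_mul_ham (N : ℕ) (β m t : ℝ) (σ : Fin N → Bool) :
    Integrable (fun g => Real.exp (t * ham N β m g σ)) (couplings N) ∧
      ∫ g, Real.exp (t * ham N β m g σ) ∂(couplings N) =
        Real.exp ((t ^ 2 - t) * (β ^ 2 / (4 * N)) * quartic N m σ) := by
  set a : Fin N × Fin N → ℝ := fun k =>
    t * (β / Real.sqrt 2) * ((spin (σ k.1) - m) * (spin (σ k.2) - m)) with ha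
  have hsum : ∑ k, a k ^ 2 = t ^ 2 * (β ^ 2 / 2) * quartic N m σ := by
    simp only [ha, Fintype.sum_prod_type, quartic, Finset.mul_sum, mul_pow, div_pow,
      Real.sq_sqrt (zero_le_two (α := ℝ))]
  have hham : ∀ g, Real.exp (t * ham N β m g σ) =
      Real.exp (-(t * (β ^ 2 / (4 * N)) * quartic N m σ)) * Real.exp (∑ k, a k * g k) := by
    intro g
    rw [← Real.exp_add]
    congr 1
    have : ∑ k, a k * g k = t * ((β / Real.sqrt 2) * ∑ i : Fin N, ∑ j : Fin N,
        g (i, j) * (spin (σ i) - m) * (spin (σ j) - m)) := by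
      simp only [ha, Fintype.sum_prod_type, Finset.mul_sum]
      exact Finset.sum_congr rfl fun i _ => Finset.sum_congr rfl fun j _ => by ring
    rw [this, ham, quartic]
    ring
  obtain ⟨hi, he⟩ := couplings_exp_linear N a
  simp only [hham]
  refine ⟨hi.const_mul _, ?_⟩
  rw [integral_const_mul, he, hsum, ← Real.exp_add]
  congr 1
  by_cases hN : (N : ℝ) = 0
  · simp [hN]
  · field_simp
    ring

lemma pm_pos (N : ℕ) {m : ℝ} (hm : m ∈ Set.Ioo (-1 : ℝ) 1) (σ : Fin N → Bool) :
    0 < pm N m σ := by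
  refine Finset.prod_pos fun i _ => ?_
  obtain ⟨h1, h2⟩ := hm
  rcases spin_eq_or (σ i) with h | h <;> rw [h] <;> linarith

lemma sum_prod_bool (N : ℕ) (f : Bool → ℝ) :
    ∑ σ : Fin N → Bool, ∏ i, f (σ i) = (f true + f false) ^ N := by
  have h := Finset.prod_univ_sum (fun _ : Fin N => (Finset.univ : Finset Bool)) fun _ b => f b
  rw [Fintype.piFinset_univ] at h
  rw [← h]
  simp

lemma sum_pm (N : ℕ) (m : ℝ) : ∑ σ, pm N m σ = 1 := by
  unfold pm
  rw [sum_prod_bool N fun b => (1 + m * spin b) / 2]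
  simp only [spin, if_true, Bool.false_eq_true, if_false]
  rw [show (1 + m * 1) / 2 + (1 + m * -1) / 2 = 1 by ring, one_pow]

/-- Sub-Gaussian bound for the exponential moments of the centered magnetization. -/
lemma sum_pm_mul_exp_le (N : ℕ) {m t : ℝ} (hm : m ∈ Set.Ioo (-1 : ℝ) 1) (ht : |t| ≤ 1 / 2) :
    ∑ σ, pm N m σ * Real.exp (t * ∑ i, (spin (σ i) - m)) ≤ Real.exp (N * t ^ 2) := by
  obtain ⟨h1, h2⟩ := hm
  have hexp : ∀ x : ℝ, |x| ≤ 1 → Real.exp x ≤ 1 + x + x ^ 2 := fun x hx => by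
    linarith [le_abs_self (Real.exp x - 1 - x), Real.abs_exp_sub_one_sub_id_le hx]
  have habs : ∀ y : ℝ, |y| ≤ 2 → |t * y| ≤ 1 := fun y hy => by
    rw [abs_mul]
    nlinarith [abs_nonneg t, abs_nonneg y]
  have hp := hexp (t * (1 - m)) (habs _ (abs_le.2 ⟨by linarith, by linarith⟩))
  have hn := hexp (t * (-1 - m)) (habs _ (abs_le.2 ⟨by linarith, by linarith⟩))
  have hsum : ∑ σ, pm N m σ * Real.exp (t * ∑ i, (spin (σ i) - m)) =
      ((1 + m) / 2 * Real.exp (t * (1 - m)) + (1 - m) / 2 * Real.exp (t * (-1 - m))) ^ N := by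
    simp only [pm, Finset.mul_sum, Real.exp_sum, ← Finset.prod_mul_distrib]
    rw [sum_prod_bool N fun b => (1 + m * spin b) / 2 * Real.exp (t * (spin b - m))]
    simp only [spin, if_true, Bool.false_eq_true, if_false]
    ring_nf
  rw [hsum, Real.exp_nat_mul]
  refine pow_le_pow_left₀ ?_ ?_ N
  · have := Real.exp_pos (t * (1 - m))
    have := Real.exp_pos (t * (-1 - m))
    have : 0 ≤ 1 + m := by linarith
    have : 0 ≤ 1 - m := by linarith
    positivity
  · have hp' := mul_le_mul_of_nonneg_left hp (by linarith : 0 ≤ (1 + m) / 2)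
    have hn' := mul_le_mul_of_nonneg_left hn (by linarith : 0 ≤ (1 - m) / 2)
    have := Real.add_one_le_exp (t ^ 2)
    nlinarith [mul_nonneg (sq_nonneg t) (sq_nonneg m)]

/-- The configurations outside `S_{N,m,ε}` have exponentially small weight. -/
lemma exists_sum_pm_compl_le {m ε : ℝ} (hm : m ∈ Set.Ioo (-1 : ℝ) 1) (hε : 0 < ε) :
    ∃ c : ℝ, 0 < c ∧ ∀ N : ℕ, 0 < N →
      ∑ σ ∈ (SNset N m ε)ᶜ, pm N m σ ≤ 2 * Real.exp (-(c * N)) := by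
  set t : ℝ := min (ε / 2) (1 / 2) with ht
  have ht0 : 0 < t := lt_min (by linarith) (by norm_num)
  have ht1 : t ≤ ε / 2 := min_le_left _ _
  have ht2 : |t| ≤ 1 / 2 := by rw [abs_of_pos ht0]; exact min_le_right _ _
  refine ⟨t * ε / 2, by positivity, fun N hN => ?_⟩
  have hN' : (0 : ℝ) < N := by exact_mod_cast hN
  have key : ∀ σ ∈ (SNset N m ε)ᶜ, Real.exp (t * ε * N) ≤
      Real.exp (t * ∑ i, (spin (σ i) - m)) + Real.exp (-t * ∑ i, (spin (σ i) - m)) := by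
    intro σ hσ
    have hsum : ∑ i, (spin (σ i) - m) = ∑ i, spin (σ i) - N * m := by
      simp [Finset.sum_sub_distrib]
    simp only [SNset, Finset.mem_compl, Finset.mem_filter, Finset.mem_univ, true_and,
      Set.mem_Icc, not_and_or, not_le] at hσ
    rw [inv_mul_eq_div, div_lt_iff₀ hN', lt_div_iff₀ hN'] at hσ
    rw [hsum]
    rcases hσ with h | h
    · refine le_add_of_nonneg_of_le (Real.exp_pos _).le (Real.exp_le_exp.2 ?_)
      nlinarith
    · refine le_add_of_le_of_nonneg (Real.exp_le_exp.2 ?_) (Real.exp_pos _).le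
      nlinarith
  have hmul : (∑ σ ∈ (SNset N m ε)ᶜ, pm N m σ) * Real.exp (t * ε * N) ≤
      2 * Real.exp (N * t ^ 2) := by
    rw [Finset.sum_mul]
    calc ∑ σ ∈ (SNset N m ε)ᶜ, pm N m σ * Real.exp (t * ε * N)
        ≤ ∑ σ ∈ (SNset N m ε)ᶜ, pm N m σ * (Real.exp (t * ∑ i, (spin (σ i) - m)) +
            Real.exp (-t * ∑ i, (spin (σ i) - m))) :=
          Finset.sum_le_sum fun σ hσ => mul_le_mul_of_nonneg_left (key σ hσ) (pm_pos N hm σ).le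
      _ ≤ ∑ σ, pm N m σ * (Real.exp (t * ∑ i, (spin (σ i) - m)) +
            Real.exp (-t * ∑ i, (spin (σ i) - m))) :=
          Finset.sum_le_sum_of_subset_of_nonneg (Finset.subset_univ _) fun σ _ _ =>
            mul_nonneg (pm_pos N hm σ).le (by positivity)
      _ ≤ 2 * Real.exp (N * t ^ 2) := by
          simp only [mul_add, Finset.sum_add_distrib]
          have h1 := sum_pm_mul_exp_le N hm ht2
          have h2 := sum_pm_mul_exp_le N (t := -t) hm (by rwa [abs_neg])
          rw [neg_sq] at h2
          linarith
  rw [← le_div_iff₀ (Real.exp_pos _), mul_div_assoc, ← Real.exp_sub] at hmul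
  refine hmul.trans (mul_le_mul_of_nonneg_left (Real.exp_le_exp.2 ?_) zero_le_two)
  nlinarith [mul_nonneg ht0.le (sub_nonneg.2 ht1)]

/-- The partition function restricted to a set `T` of configurations. -/
noncomputable def partialZ (N : ℕ) (β m : ℝ) (T : Finset (Fin N → Bool)) (g : Fin N × Fin N → ℝ) : ℝ :=
  ∑ σ ∈ T, pm N m σ * Real.exp (ham N β m g σ)

lemma integrable_partialZ (N : ℕ) (β m : ℝ) (T : Finset (Fin N → Bool)) :
    Integrable (partialZ N β m T) (couplings N) :=
  integrable_finsetSum _ fun σ _ =>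
    (by simpa using (exp_mul_ham N β m 1 σ).1 :
      Integrable (fun g => Real.exp (ham N β m g σ)) (couplings N)).const_mul _

lemma integral_partialZ (N : ℕ) (β m : ℝ) (T : Finset (Fin N → Bool)) :
    ∫ g, partialZ N β m T g ∂(couplings N) = ∑ σ ∈ T, pm N m σ := by
  unfold partialZ
  have hi : ∀ σ, Integrable (fun g => Real.exp (ham N β m g σ)) (couplings N) := fun σ => by
    simpa using (exp_mul_ham N β m 1 σ).1
  rw [integral_finsetSum _ fun σ _ => (hi σ).const_mul _]
  refine Finset.sum_congr rfl fun σ _ => ?_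
  have h := (exp_mul_ham N β m 1 σ).2
  norm_num at h
  rw [integral_const_mul, h, mul_one]

lemma sq_le_two_mul_exp_add_exp_neg (x : ℝ) :
    x ^ 2 ≤ 2 * (Real.exp x + Real.exp (-x)) := by
  rcases le_total 0 x with h | h
  · nlinarith [Real.quadratic_le_exp_of_nonneg h, Real.exp_pos (-x)]
  · nlinarith [Real.quadratic_le_exp_of_nonneg (neg_nonneg.2 h), Real.exp_pos x]

/-- A random variable with bounded mean dominating the square of the Jensen lower bound for the
free energy. -/
noncomputable def energySq (N : ℕ) (β m : ℝ) (g : Fin N × Fin N → ℝ) : ℝ :=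
  2 + 4 * ∑ σ, pm N m σ * (2 * (Real.exp ((N : ℝ)⁻¹ * ham N β m g σ) +
    Real.exp (-(N : ℝ)⁻¹ * ham N β m g σ)))

lemma integrable_energySq (N : ℕ) (β m : ℝ) :
    Integrable (energySq N β m) (couplings N) :=
  (integrable_const _).add <| (integrable_finsetSum _ fun σ _ =>
    (((exp_mul_ham N β m _ σ).1.add (exp_mul_ham N β m _ σ).1).const_mul _).const_mul _).const_mul _

lemma integral_energySq_le {N : ℕ} (hN : 0 < N) (β : ℝ) {m : ℝ} (hm : m ∈ Set.Ioo (-1 : ℝ) 1) :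
    ∫ g, energySq N β m g ∂(couplings N) ≤ 2 + 8 * (1 + Real.exp (8 * β ^ 2)) := by
  have hN1 : (1 : ℝ) ≤ N := by exact_mod_cast hN
  have hN0 : (0 : ℝ) < N := by linarith
  have hinv : (N : ℝ)⁻¹ ≤ 1 := inv_le_one_of_one_le₀ hN1
  have hinv0 : 0 < (N : ℝ)⁻¹ := inv_pos.2 hN0
  have hint : ∀ σ, Integrable (fun g => 2 * (Real.exp ((N : ℝ)⁻¹ * ham N β m g σ) +
      Real.exp (-(N : ℝ)⁻¹ * ham N β m g σ))) (couplings N) := fun σ =>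
    ((exp_mul_ham N β m _ σ).1.add (exp_mul_ham N β m _ σ).1).const_mul _
  have hone : ∀ σ, ∫ g, 2 * (Real.exp ((N : ℝ)⁻¹ * ham N β m g σ) +
      Real.exp (-(N : ℝ)⁻¹ * ham N β m g σ)) ∂(couplings N) ≤
        2 * (1 + Real.exp (8 * β ^ 2)) := by
    intro σ
    rw [integral_const_mul, integral_add (exp_mul_ham N β m _ σ).1 (exp_mul_ham N β m _ σ).1,
      (exp_mul_ham N β m _ σ).2, (exp_mul_ham N β m _ σ).2]
    have hq0 := quartic_nonneg N m σ
    have hq := quartic_le N hm σ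
    have hA : 0 ≤ β ^ 2 / (4 * N) * quartic N m σ := by positivity
    have hA' : β ^ 2 / (4 * N) * quartic N m σ ≤ 4 * β ^ 2 * N := by
      calc β ^ 2 / (4 * N) * quartic N m σ ≤ β ^ 2 / (4 * N) * (16 * (N : ℝ) ^ 2) := by gcongr
        _ = 4 * β ^ 2 * N := by field_simp; ring
    refine mul_le_mul_of_nonneg_left (add_le_add ?_ (Real.exp_le_exp.2 ?_)) zero_le_two
    · rw [← Real.exp_zero]
      refine Real.exp_le_exp.2 ?_
      rw [mul_assoc]
      exact mul_nonpos_of_nonpos_of_nonneg (by nlinarith) hA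
    · rw [mul_assoc]
      calc ((-(N : ℝ)⁻¹) ^ 2 - -(N : ℝ)⁻¹) * (β ^ 2 / (4 * N) * quartic N m σ)
          ≤ (2 * (N : ℝ)⁻¹) * (4 * β ^ 2 * N) := by
            refine mul_le_mul (by nlinarith) hA' hA (by positivity)
        _ = 8 * β ^ 2 := by field_simp; ring
  unfold energySq
  rw [integral_add (integrable_const _)
    ((integrable_finsetSum _ fun σ _ => (hint σ).const_mul _).const_mul _),
    integral_const_mul, integral_finsetSum _ fun σ _ => (hint σ).const_mul _]
  simp only [integral_const_mul, integral_const, probReal_univ, smul_eq_mul, one_mul]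
  have hle : ∑ σ, pm N m σ * (2 * ∫ g, (Real.exp ((N : ℝ)⁻¹ * ham N β m g σ) +
      Real.exp (-(N : ℝ)⁻¹ * ham N β m g σ)) ∂(couplings N)) ≤
        ∑ σ, pm N m σ * (2 * (1 + Real.exp (8 * β ^ 2))) :=
    Finset.sum_le_sum fun σ _ => mul_le_mul_of_nonneg_left
      (by simpa only [integral_const_mul] using hone σ) (pm_pos N hm σ).le
  rw [← Finset.sum_mul, sum_pm, one_mul] at hle
  linarith

/-- Jensen's inequality bounds the free energy from below by a variable whose square is at most
`energySq`. -/
lemma exists_le_log_partialZ {N : ℕ} (hN : 0 < N) (β : ℝ) {m : ℝ} (hm : m ∈ Set.Ioo (-1 : ℝ) 1)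
    {T : Finset (Fin N → Bool)} (hT : 1 / 2 ≤ ∑ σ ∈ T, pm N m σ) (g : Fin N × Fin N → ℝ) :
    0 < partialZ N β m T g ∧
      ∃ L : ℝ, L ≤ (N : ℝ)⁻¹ * Real.log (partialZ N β m T g) ∧ L ^ 2 ≤ energySq N β m g := by
  set P := ∑ σ ∈ T, pm N m σ with hP
  have hP0 : 0 < P := by linarith
  have hP1 : P ≤ 1 := by
    rw [← sum_pm N m]
    exact Finset.sum_le_sum_of_subset_of_nonneg (Finset.subset_univ _)
      fun σ _ _ => (pm_pos N hm σ).le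
  have hN1 : (1 : ℝ) ≤ N := by exact_mod_cast hN
  have hN0 : (0 : ℝ) < N := by linarith
  have hinv : (N : ℝ)⁻¹ ≤ 1 := inv_le_one_of_one_le₀ hN1
  have hinv0 : 0 < (N : ℝ)⁻¹ := inv_pos.2 hN0
  set a := (∑ σ ∈ T, pm N m σ * ham N β m g σ) / P with ha
  have haP : ∑ σ ∈ T, pm N m σ * ham N β m g σ = a * P := by rw [ha]; field_simp
  have hlow : P * Real.exp a ≤ partialZ N β m T g := by
    have : ∑ σ ∈ T, pm N m σ * (Real.exp a * (1 + (ham N β m g σ - a))) = P * Real.exp a := by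
      have : ∀ σ, pm N m σ * (Real.exp a * (1 + (ham N β m g σ - a))) =
          Real.exp a * (1 - a) * pm N m σ + Real.exp a * (pm N m σ * ham N β m g σ) :=
        fun σ => by ring
      simp only [this, Finset.sum_add_distrib, ← Finset.mul_sum, haP, ← hP]
      ring
    rw [← this]
    refine Finset.sum_le_sum fun σ _ => mul_le_mul_of_nonneg_left ?_ (pm_pos N hm σ).le
    calc Real.exp a * (1 + (ham N β m g σ - a))
        ≤ Real.exp a * Real.exp (ham N β m g σ - a) :=
          mul_le_mul_of_nonneg_left (by linarith [Real.add_one_le_exp (ham N β m g σ - a)])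
            (Real.exp_pos _).le
      _ = Real.exp (ham N β m g σ) := by rw [← Real.exp_add]; congr 1; ring
  have hpos : 0 < P * Real.exp a := mul_pos hP0 (Real.exp_pos _)
  refine ⟨hpos.trans_le hlow, (N : ℝ)⁻¹ * (Real.log P + a), ?_, ?_⟩
  · refine mul_le_mul_of_nonneg_left ?_ hinv0.le
    have hlog := Real.log_mul hP0.ne' (Real.exp_pos a).ne'
    rw [Real.log_exp] at hlog
    rw [← hlog]
    exact Real.log_le_log hpos hlow
  · have hlog : ((N : ℝ)⁻¹ * Real.log P) ^ 2 ≤ 1 := by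
      have h1 : Real.log P ≤ 0 := Real.log_nonpos hP0.le hP1
      have h2 : -1 ≤ Real.log P := by
        have := Real.one_sub_inv_le_log_of_pos hP0
        have : P⁻¹ ≤ 2 := by
          rw [inv_le_comm₀ hP0 two_pos]; linarith
        linarith
      rw [mul_pow]
      exact mul_le_one₀ (by nlinarith) (sq_nonneg _) (by nlinarith)
    have hcs : ((N : ℝ)⁻¹ * a) ^ 2 * P ≤
        ∑ σ ∈ T, pm N m σ * ((N : ℝ)⁻¹ * ham N β m g σ) ^ 2 := by
      have h0 : 0 ≤ ∑ σ ∈ T, pm N m σ * ((N : ℝ)⁻¹ * ham N β m g σ - (N : ℝ)⁻¹ * a) ^ 2 :=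
        Finset.sum_nonneg fun σ _ => mul_nonneg (pm_pos N hm σ).le (sq_nonneg _)
      have : ∀ σ, pm N m σ * ((N : ℝ)⁻¹ * ham N β m g σ - (N : ℝ)⁻¹ * a) ^ 2 =
          pm N m σ * ((N : ℝ)⁻¹ * ham N β m g σ) ^ 2 -
            2 * (N : ℝ)⁻¹ ^ 2 * a * (pm N m σ * ham N β m g σ) +
            ((N : ℝ)⁻¹ * a) ^ 2 * pm N m σ := fun σ => by ring
      simp only [this, Finset.sum_add_distrib, Finset.sum_sub_distrib, ← Finset.mul_sum, haP,
        ← hP] at h0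
      nlinarith
    have hR : ∑ σ ∈ T, pm N m σ * ((N : ℝ)⁻¹ * ham N β m g σ) ^ 2 ≤
        ∑ σ, pm N m σ * (2 * (Real.exp ((N : ℝ)⁻¹ * ham N β m g σ) +
          Real.exp (-(N : ℝ)⁻¹ * ham N β m g σ))) := by
      refine (Finset.sum_le_sum_of_subset_of_nonneg (Finset.subset_univ _) fun σ _ _ =>
        mul_nonneg (pm_pos N hm σ).le (sq_nonneg _)).trans ?_
      refine Finset.sum_le_sum fun σ _ => mul_le_mul_of_nonneg_left ?_ (pm_pos N hm σ).le
      rw [neg_mul]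
      exact sq_le_two_mul_exp_add_exp_neg _
    have ha2 : ((N : ℝ)⁻¹ * a) ^ 2 ≤ 2 * (((N : ℝ)⁻¹ * a) ^ 2 * P) := by
      nlinarith [sq_nonneg ((N : ℝ)⁻¹ * a)]
    rw [mul_add, energySq]
    linarith [add_sq_le (a := (N : ℝ)⁻¹ * Real.log P) (b := (N : ℝ)⁻¹ * a)]

lemma integrable_log_partialZ {N : ℕ} (hN : 0 < N) (β : ℝ) {m : ℝ} (hm : m ∈ Set.Ioo (-1 : ℝ) 1)
    {T : Finset (Fin N → Bool)} (hT : 1 / 2 ≤ ∑ σ ∈ T, pm N m σ) :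
    Integrable (fun g => (N : ℝ)⁻¹ * Real.log (partialZ N β m T g)) (couplings N) := by
  have hmeas : AEStronglyMeasurable (fun g => (N : ℝ)⁻¹ * Real.log (partialZ N β m T g))
      (couplings N) :=
    ((Real.measurable_log.comp_aemeasurable
      (integrable_partialZ N β m T).aemeasurable).const_mul _).aestronglyMeasurable
  refine (((integrable_const (1 : ℝ)).add (integrable_energySq N β m)).add
    (integrable_partialZ N β m T)).mono' hmeas (Eventually.of_forall fun g => ?_)
  obtain ⟨hpos, L, hL, hL2⟩ := exists_le_log_partialZ hN β hm hT g
  have hN1 : (1 : ℝ) ≤ N := by exact_mod_cast hN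
  have hinv : (N : ℝ)⁻¹ ≤ 1 := inv_le_one_of_one_le₀ hN1
  have hinv0 : 0 < (N : ℝ)⁻¹ := inv_pos.2 (by linarith)
  have hup : (N : ℝ)⁻¹ * Real.log (partialZ N β m T g) ≤ partialZ N β m T g := by
    have := Real.log_le_sub_one_of_pos hpos
    nlinarith
  simp only [Pi.add_apply, Real.norm_eq_abs]
  rw [abs_le]
  constructor <;> nlinarith [sq_nonneg (L + 1), sq_nonneg L]

/-- Pointwise lower bound for the restricted free energy in terms of the full one. -/
lemma le_log_partialZ {N : ℕ} (hN : 0 < N) (β : ℝ) {m : ℝ} (hm : m ∈ Set.Ioo (-1 : ℝ) 1)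
    {T : Finset (Fin N → Bool)} (hT : 1 / 2 ≤ ∑ σ ∈ T, pm N m σ) {δ : ℝ} (hδ : 0 < δ)
    (g : Fin N × Fin N → ℝ) :
    -δ - (N : ℝ)⁻¹ - δ * energySq N β m g
      - 1 / (4 * δ ^ 2) * (2 * (N : ℝ)⁻¹ * Z N β m g - (N : ℝ)⁻¹ * Real.log (Z N β m g))
      - 1 / (2 * δ) * Real.exp (δ * N) * partialZ N β m Tᶜ g
      ≤ (N : ℝ)⁻¹ * Real.log (partialZ N β m T g) := by
  have hN0 : (0 : ℝ) < N := by exact_mod_cast hN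
  have hinv0 : 0 < (N : ℝ)⁻¹ := inv_pos.2 hN0
  obtain ⟨hpos, L, hL, hL2⟩ := exists_le_log_partialZ hN β hm hT g
  have hsplit : partialZ N β m T g + partialZ N β m Tᶜ g = Z N β m g :=
    Finset.sum_add_sum_compl T _
  have hW0 : 0 ≤ partialZ N β m Tᶜ g := Finset.sum_nonneg fun σ _ =>
    mul_nonneg (pm_pos N hm σ).le (Real.exp_pos _).le
  have hZ0 : 0 < Z N β m g := by linarith
  have hR0 : 0 ≤ energySq N β m g := (sq_nonneg L).trans hL2
  set W := partialZ N β m Tᶜ g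
  set X := (N : ℝ)⁻¹ * Real.log (Z N β m g) with hX
  set V := 2 * (N : ℝ)⁻¹ * Z N β m g - X with hV
  have hXle : X ≤ (N : ℝ)⁻¹ * Z N β m g :=
    mul_le_mul_of_nonneg_left (by linarith [Real.log_le_sub_one_of_pos hZ0]) hinv0.le
  have hZN : 0 < (N : ℝ)⁻¹ * Z N β m g := mul_pos hinv0 hZ0
  have hV0 : 0 ≤ V := by linarith
  have hVX : -X ≤ V := by linarith
  have hA : 0 ≤ 1 / (4 * δ ^ 2) * V := by positivity
  have hB : 0 ≤ 1 / (2 * δ) * Real.exp (δ * N) * W := by positivity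
  have hδR : 0 ≤ δ * energySq N β m g := by positivity
  have hbad : 1 / (4 * δ) ≤ 1 / (4 * δ ^ 2) * V + 1 / (2 * δ) * Real.exp (δ * N) * W →
      -δ - (N : ℝ)⁻¹ - δ * energySq N β m g - 1 / (4 * δ ^ 2) * V
        - 1 / (2 * δ) * Real.exp (δ * N) * W ≤ (N : ℝ)⁻¹ * Real.log (partialZ N β m T g) := by
    intro h
    have : 0 ≤ δ * L ^ 2 + L + 1 / (4 * δ) := by
      have : δ * L ^ 2 + L + 1 / (4 * δ) = δ * (L + 1 / (2 * δ)) ^ 2 := by field_simp; ring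
      rw [this]
      positivity
    nlinarith
  rcases lt_or_ge X (-δ) with h1 | h1
  · refine hbad (le_add_of_le_of_nonneg ?_ hB)
    calc 1 / (4 * δ) = 1 / (4 * δ ^ 2) * δ := by field_simp
      _ ≤ 1 / (4 * δ ^ 2) * V := by gcongr; linarith
  rcases lt_or_ge (Real.exp (-(δ * N)) / 2) W with h2 | h2
  · refine hbad (le_add_of_nonneg_of_le hA ?_)
    calc 1 / (4 * δ) = 1 / (2 * δ) * Real.exp (δ * N) * (Real.exp (-(δ * N)) / 2) := by
          rw [Real.exp_neg]; field_simp; norm_num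
      _ ≤ _ := by gcongr
  · have hZlow : Real.exp (-(δ * N)) ≤ Z N β m g := by
      rw [← Real.le_log_iff_exp_le hZ0]
      have := mul_le_mul_of_nonneg_left h1 hN0.le
      rw [hX, mul_inv_cancel_left₀ hN0.ne'] at this
      linarith
    have hlow : Real.exp (-(δ * N) - 1) ≤ partialZ N β m T g := by
      have he : Real.exp (-1) ≤ 1 / 2 := by
        have := Real.exp_one_gt_two
        rw [Real.exp_neg, one_div]
        gcongr
      rw [sub_eq_add_neg, Real.exp_add]
      nlinarith [Real.exp_pos (-(δ * N))]
    have := mul_le_mul_of_nonneg_left ((Real.le_log_iff_exp_le hpos).2 hlow) hinv0.le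
    have h3 : (N : ℝ)⁻¹ * (-(δ * N) - 1) = -δ - (N : ℝ)⁻¹ := by field_simp
    linarith

/-- if `β ∈ HT_m`, then for every `ε > 0`,
`lim_{N→∞} E[(1/N) log Z^{≤ε}_{N,β,m}] = 0`. -/
theorem statement2 (β m : ℝ) (hβ : 0 ≤ β) (hm : m ∈ Set.Ioo (-1 : ℝ) 1)
    (hHT : Tendsto (fun N : ℕ => F N β m) atTop (nhds 0))
    (ε : ℝ) (hε : 0 < ε) :
    Tendsto (fun N : ℕ => Fres N β m ε) atTop (nhds 0) := by
  obtain ⟨c, hc, hcomp⟩ := exists_sum_pm_compl_le hm hε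
  set C : ℝ := 2 + 8 * (1 + Real.exp (8 * β ^ 2)) with hC
  have hC0 : 0 < C := by positivity
  have hexp : ∀ a : ℝ, 0 < a → Tendsto (fun N : ℕ => Real.exp (-(a * N))) atTop (nhds 0) :=
    fun a ha => Real.tendsto_exp_neg_atTop_nhds_zero.comp
      (tendsto_natCast_atTop_atTop.const_mul_atTop ha)
  have hinvN : Tendsto (fun N : ℕ => (N : ℝ)⁻¹) atTop (nhds 0) := tendsto_inv_atTop_nhds_zero_nat
  have hlarge : ∀ᶠ N : ℕ in atTop, 0 < N ∧ 1 / 2 ≤ ∑ σ ∈ SNset N m ε, pm N m σ := by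
    filter_upwards [eventually_gt_atTop 0,
      (hexp c hc).eventually (gt_mem_nhds (by norm_num : (0 : ℝ) < 1 / 4))] with N hN hN4
    refine ⟨hN, ?_⟩
    have h := Finset.sum_add_sum_compl (SNset N m ε) (pm N m)
    rw [sum_pm] at h
    linarith [hcomp N hN]
  have hintX : ∀ N : ℕ, 0 < N →
      Integrable (fun g => (N : ℝ)⁻¹ * Real.log (Z N β m g)) (couplings N) := fun N hN =>
    integrable_log_partialZ hN β hm (T := Finset.univ) (by rw [sum_pm]; norm_num)
  have hupper : ∀ᶠ N : ℕ in atTop, Fres N β m ε ≤ F N β m := by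
    filter_upwards [hlarge] with N ⟨hN, hT⟩
    refine integral_mono (integrable_log_partialZ hN β hm hT) (hintX N hN) fun g => ?_
    refine mul_le_mul_of_nonneg_left (Real.log_le_log
      (exists_le_log_partialZ hN β hm hT g).1 ?_) (by positivity)
    exact Finset.sum_le_sum_of_subset_of_nonneg (Finset.subset_univ _) fun σ _ _ =>
      mul_nonneg (pm_pos N hm σ).le (Real.exp_pos _).le
  have hlower : ∀ δ : ℝ, 0 < δ → ∀ᶠ N : ℕ in atTop,
      -δ - (N : ℝ)⁻¹ - δ * C - 1 / (4 * δ ^ 2) * (2 * (N : ℝ)⁻¹ - F N β m)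
        - 1 / δ * Real.exp (-((c - δ) * N)) ≤ Fres N β m ε := by
    intro δ hδ
    filter_upwards [hlarge] with N ⟨hN, hT⟩
    have hiR := integrable_energySq N β m
    have hiZ : Integrable (Z N β m) (couplings N) := integrable_partialZ N β m Finset.univ
    have hiX := hintX N hN
    have hiW := integrable_partialZ N β m (SNset N m ε)ᶜ
    have i1 := (integrable_const (μ := couplings N) (-δ - (N : ℝ)⁻¹)).sub (hiR.const_mul δ)
    have i2 := ((hiZ.const_mul (2 * (N : ℝ)⁻¹)).sub hiX).const_mul (1 / (4 * δ ^ 2))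
    have i3 := hiW.const_mul (1 / (2 * δ) * Real.exp (δ * N))
    have hmono := integral_mono ((i1.sub i2).sub i3) (integrable_log_partialZ hN β hm hT)
      fun g => le_log_partialZ hN β hm hT hδ g
    have hval : ∫ g, (((-δ - (N : ℝ)⁻¹) - δ * energySq N β m g) - 1 / (4 * δ ^ 2) *
        (2 * (N : ℝ)⁻¹ * Z N β m g - (N : ℝ)⁻¹ * Real.log (Z N β m g))) -
        1 / (2 * δ) * Real.exp (δ * N) * partialZ N β m (SNset N m ε)ᶜ g ∂(couplings N) =
        -δ - (N : ℝ)⁻¹ - δ * ∫ g, energySq N β m g ∂(couplings N) -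
          1 / (4 * δ ^ 2) * (2 * (N : ℝ)⁻¹ - F N β m) -
          1 / (2 * δ) * Real.exp (δ * N) * ∑ σ ∈ (SNset N m ε)ᶜ, pm N m σ := by
      have hZ1 : ∫ g, Z N β m g ∂(couplings N) = 1 :=
        (integral_partialZ N β m Finset.univ).trans (sum_pm N m)
      have e1 : ∫ g, (((-δ - (N : ℝ)⁻¹) - δ * energySq N β m g) - 1 / (4 * δ ^ 2) *
          (2 * (N : ℝ)⁻¹ * Z N β m g - (N : ℝ)⁻¹ * Real.log (Z N β m g))) -
          1 / (2 * δ) * Real.exp (δ * N) * partialZ N β m (SNset N m ε)ᶜ g ∂(couplings N) = _ :=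
        integral_sub (i1.sub i2) i3
      have e2 := integral_sub i1 i2
      have e3 := integral_sub (integrable_const (μ := couplings N) (-δ - (N : ℝ)⁻¹))
        (hiR.const_mul δ)
      have e4 := integral_sub (hiZ.const_mul (2 * (N : ℝ)⁻¹)) hiX
      simp only [Pi.sub_apply] at e1 e2 e3 e4
      rw [e1, e2, e3, integral_const_mul, integral_const_mul, integral_const_mul, e4,
        integral_const_mul, hZ1, integral_partialZ]
      simp [F]
    have hmono' : _ ≤ Fres N β m ε := hval.symm.le.trans hmono
    have hR := mul_le_mul_of_nonneg_left (integral_energySq_le hN β hm) hδ.le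
    have hW : 1 / (2 * δ) * Real.exp (δ * N) * ∑ σ ∈ (SNset N m ε)ᶜ, pm N m σ ≤
        1 / δ * Real.exp (-((c - δ) * N)) := by
      calc _ ≤ 1 / (2 * δ) * Real.exp (δ * N) * (2 * Real.exp (-(c * N))) :=
            mul_le_mul_of_nonneg_left (hcomp N hN) (by positivity)
        _ = 1 / δ * (Real.exp (δ * N) * Real.exp (-(c * N))) := by field_simp
        _ = _ := by rw [← Real.exp_add]; congr 2; ring
    linarith
  rw [tendsto_order]
  refine ⟨fun a ha => ?_, fun a ha => ?_⟩
  · set δ := min (c / 2) (-a / (2 * (1 + C))) with hδ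
    have hδ0 : 0 < δ := lt_min (by linarith) (div_pos (by linarith) (by linarith))
    have hδc : δ ≤ c / 2 := min_le_left _ _
    have hδa : δ * (2 * (1 + C)) ≤ -a :=
      (le_div_iff₀ (by linarith)).1 (min_le_right _ _)
    have hlim : Tendsto (fun N : ℕ => -δ - (N : ℝ)⁻¹ - δ * C -
        1 / (4 * δ ^ 2) * (2 * (N : ℝ)⁻¹ - F N β m) - 1 / δ * Real.exp (-((c - δ) * N)))
        atTop (nhds (-δ - 0 - δ * C - 1 / (4 * δ ^ 2) * (2 * 0 - 0) - 1 / δ * 0)) :=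
      (((tendsto_const_nhds.sub hinvN).sub tendsto_const_nhds).sub
        (((hinvN.const_mul 2).sub hHT).const_mul _)).sub
        ((hexp (c - δ) (by linarith)).const_mul _)
    have hlt : a < -δ - 0 - δ * C - 1 / (4 * δ ^ 2) * (2 * 0 - 0) - 1 / δ * 0 := by
      linarith [mul_pos hδ0 (by linarith : 0 < 1 + C)]
    filter_upwards [hlower δ hδ0, hlim.eventually (lt_mem_nhds hlt)] with N h1 h2
    exact h2.trans_le h1
  · filter_upwards [hupper, hHT.eventually (gt_mem_nhds ha)] with N h1 h2
    exact h1.trans_lt h2
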